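/- For every k ≥ 1 there exist constants κ_1, κ_2 > 0 such that for all x ∈ ℝ^d with |x| ≥ 1 and all u ∈ M(x): Σ_{i=1}^d b_i(x,u) ∂_i(|x|^k) ≤ κ_1 |x|^{k-1} - κ_2 |x|^k, where ∂_i(|x|^k) = k|x|^{k-2} x_i. -/

import Mathlib

open Finset

noncomputable section

/-- `d × d` real matrices represented as functions. -/
abbrev Mat (d : ℕ) := Fin d → Fin d → ℝ

/-- Euclidean space `ℝ^d`. -/
abbrev E (d : ℕ) := EuclideanSpace ℝ (Fin d)

/-- positive part `a⁺ = max(a,0)`. -/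
def pp (a : ℝ) : ℝ := max a 0

/-- negative part `a⁻ = max(-a,0)`. -/
def nn (a : ℝ) : ℝ := max (-a) 0

/-- The control set `M`: nonnegative matrices with zero diagonal whose
column sums (off the diagonal) are at most `1`. -/
def MM (d : ℕ) : Set (Mat d) :=
  {u | (∀ i j, 0 ≤ u i j) ∧ (∀ i, u i i = 0) ∧
    ∀ i, ∑ k ∈ univ.filter (· ≠ i), u k i ≤ 1}

/-- The state-dependent control set `M(x)`. -/
def Mx (d : ℕ) (x : E d) : Set (Mat d) :=
  {u | u ∈ MM d ∧ ∀ i, ∑ j ∈ univ.filter (· ≠ i), u i j * nn (x j) ≤ pp (x i)}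
/-- `q_i(x,u) = x_i⁺ - Σ_{j ≠ i} u_{ij} x_j⁻`. -/
def qf (d : ℕ) (x : E d) (u : Mat d) (i : Fin d) : ℝ :=
  pp (x i) - ∑ j ∈ univ.filter (· ≠ i), u i j * nn (x j)

/-- The drift
`b_i(x,u) = ℓ_i + μ_i x_i⁻ - Σ_{j ≠ i} μ_{ij} u_{ij} x_j⁻ - γ_i q_i(x,u)`. -/
def bf (d : ℕ) (ℓ μ γ : Fin d → ℝ) (μo : Fin d → Fin d → ℝ)
    (x : E d) (u : Mat d) (i : Fin d) : ℝ :=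
  ℓ i + μ i * nn (x i) - (∑ j ∈ univ.filter (· ≠ i), μo i j * u i j * nn (x j))
    - γ i * qf d x u i


/-- A finite family of pairs of positive reals is bounded below by a common scale. -/
theorem exists_pos_le_and_mul_le {ι : Type*} [Finite ι] {a b : ι → ℝ}
    (ha : ∀ i, 0 < a i) (hb : ∀ i, 0 < b i) {C : ℝ} (hC : 0 < C) :
    ∃ ε > (0 : ℝ), ∀ i, ε ≤ a i ∧ ε * C ≤ b i := by
  cases nonempty_fintype ι
  rcases isEmpty_or_nonempty ι with h | h
  · exact ⟨1, one_pos, fun i => (h.false i).elim⟩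
  · obtain ⟨i₀, hi₀⟩ := Finite.exists_min fun i => min (a i) (b i / C)
    refine ⟨min (a i₀) (b i₀ / C), lt_min (ha _) (div_pos (hb _) hC), fun i => ⟨?_, ?_⟩⟩
    · exact (hi₀ i).trans (min_le_left _ _)
    · exact (le_div_iff₀ hC).1 ((hi₀ i).trans (min_le_right _ _))

/-- Entries of a control matrix are at most `1`. -/
theorem le_one_of_mem_MM {d : ℕ} {u : Mat d} (hu : u ∈ MM d) (i j : Fin d) : u i j ≤ 1 := by
  obtain ⟨h0, hdiag, hcol⟩ := hu
  by_cases hij : i = j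
  · rw [hij, hdiag]
    exact zero_le_one
  · refine le_trans ?_ (hcol j)
    exact single_le_sum (f := fun m => u m j) (fun m _ => h0 m j) (by simp [hij])

/-- The mass transferred to one coordinate is controlled by the squares of the negative parts. -/
theorem sq_sum_mul_nn_le {d : ℕ} {u : Mat d} (hu : u ∈ MM d) (x : E d) (i : Fin d) :
    (∑ j ∈ univ.filter (· ≠ i), u i j * nn (x j)) ^ 2 ≤ d * ∑ j, nn (x j) ^ 2 := by
  have hn : ∀ j, 0 ≤ nn (x j) := fun j => le_max_right _ _
  have hle : ∑ j ∈ univ.filter (· ≠ i), u i j * nn (x j) ≤ ∑ j, nn (x j) :=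
    (sum_le_sum fun j _ => mul_le_of_le_one_left (hn j) (le_one_of_mem_MM hu i j)).trans
      (sum_le_sum_of_subset_of_nonneg (subset_univ _) fun j _ _ => hn j)
  have h0 : 0 ≤ ∑ j ∈ univ.filter (· ≠ i), u i j * nn (x j) :=
    sum_nonneg fun j _ => mul_nonneg (hu.1 i j) (hn j)
  refine (pow_le_pow_left₀ h0 hle 2).trans ?_
  simpa using sq_sum_le_card_mul_sum_sq (s := univ) (f := fun j => nn (x j))

/-- Dissipation estimate for a single coordinate of the drift. -/
theorem bf_mul_le {d : ℕ} {ℓ μ γ : Fin d → ℝ} {μo : Fin d → Fin d → ℝ}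
    (hμo : ∀ i j, i ≠ j → 0 ≤ μo i j) {ε : ℝ} (hε : 0 < ε)
    {x : E d} {u : Mat d} (hu : u ∈ Mx d x) (i : Fin d)
    (hεγ : ε ≤ γ i) (hεμ : ε * ((d : ℝ) ^ 2 + 1 / 2) ≤ μ i) :
    bf d ℓ μ γ μo x u i * x i ≤
      |ℓ i| * ‖x‖ - ε * (d : ℝ) ^ 2 * nn (x i) ^ 2 - ε / 2 * x i ^ 2
        + ε * (d * ∑ j, nn (x j) ^ 2) := by
  obtain ⟨huM, hux⟩ := hu
  have hn : ∀ j, 0 ≤ nn (x j) := fun j => le_max_right _ _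
  have hs2 := sq_sum_mul_nn_le huM x i
  have hterm : ∀ j, 0 ≤ u i j * nn (x j) := fun j => mul_nonneg (huM.1 i j) (hn j)
  have hs0 : 0 ≤ ∑ j ∈ univ.filter (· ≠ i), u i j * nn (x j) :=
    sum_nonneg fun j _ => hterm j
  have hsi := hux i
  have hℓ : ℓ i * x i ≤ |ℓ i| * ‖x‖ :=
    (le_abs_self _).trans ((abs_mul _ _).le.trans
      (mul_le_mul_of_nonneg_left (PiLp.norm_apply_le x i) (abs_nonneg _)))
  unfold bf qf
  rcases le_total (x i) 0 with hx | hx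
  · have hp : pp (x i) = 0 := max_eq_right hx
    have hni : nn (x i) = -x i := max_eq_left (neg_nonneg.2 hx)
    rw [hp] at hsi
    have hs : ∑ j ∈ univ.filter (· ≠ i), u i j * nn (x j) = 0 := le_antisymm hsi hs0
    have hz := (sum_eq_zero_iff_of_nonneg fun j _ => hterm j).1 hs
    have ht : ∑ j ∈ univ.filter (· ≠ i), μo i j * u i j * nn (x j) = 0 :=
      sum_eq_zero fun j hj => by rw [mul_assoc, hz j hj, mul_zero]
    rw [hs] at hs2
    rw [hs, ht, hp, hni]
    have h1 := mul_le_mul_of_nonneg_right hεμ (sq_nonneg (x i))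
    have h2 := mul_nonneg hε.le (by simpa using hs2 : 0 ≤ (d : ℝ) * ∑ j, nn (x j) ^ 2)
    nlinarith
  · have hp : pp (x i) = x i := max_eq_left hx
    have hni : nn (x i) = 0 := max_eq_right (neg_nonpos.2 hx)
    have ht : 0 ≤ ∑ j ∈ univ.filter (· ≠ i), μo i j * u i j * nn (x j) :=
      sum_nonneg fun j hj => by
        rw [mul_assoc]
        exact mul_nonneg (hμo i j (mem_filter.1 hj).2.symm) (hterm j)
    rw [hp] at hsi
    rw [hp, hni]
    generalize ∑ j ∈ univ.filter (· ≠ i), u i j * nn (x j) = s at *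
    generalize ∑ j ∈ univ.filter (· ≠ i), μo i j * u i j * nn (x j) = t at *
    have h1 := mul_nonneg ht hx
    have h2 : ε * ((x i - s) * x i) ≤ γ i * ((x i - s) * x i) :=
      mul_le_mul_of_nonneg_right hεγ (mul_nonneg (sub_nonneg.2 hsi) hx)
    have h3 : x i ^ 2 / 2 - s ^ 2 ≤ (x i - s) * x i := by nlinarith [sq_nonneg (x i - s)]
    have h4 := mul_le_mul_of_nonneg_left h3 hε.le
    have h5 := mul_le_mul_of_nonneg_left hs2 hε.le
    nlinarith

/-- Dissipation estimate for the full drift. -/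
theorem sum_bf_mul_le {d : ℕ} {ℓ μ γ : Fin d → ℝ} {μo : Fin d → Fin d → ℝ}
    (hμo : ∀ i j, i ≠ j → 0 ≤ μo i j) {ε : ℝ} (hε : 0 < ε)
    (hεb : ∀ i, ε ≤ γ i ∧ ε * ((d : ℝ) ^ 2 + 1 / 2) ≤ μ i)
    {x : E d} {u : Mat d} (hu : u ∈ Mx d x) :
    ∑ i, bf d ℓ μ γ μo x u i * x i ≤ (∑ i, |ℓ i|) * ‖x‖ - ε / 2 * ‖x‖ ^ 2 := by
  refine (sum_le_sum fun i _ =>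
    bf_mul_le hμo hε hu i (hεb i).1 (hεb i).2).trans (le_of_eq ?_)
  rw [sum_add_distrib, sum_sub_distrib, sum_sub_distrib, ← sum_mul, ← mul_sum, ← mul_sum,
    EuclideanSpace.real_norm_sq_eq]
  simp only [sum_const, card_univ, Fintype.card_fin, nsmul_eq_mul]
  ring

/-- For every `k ≥ 1` there are constants `κ₁, κ₂ > 0` such that for all `x` with
`|x| ≥ 1` and all `u ∈ M(x)`:
`Σ_i b_i(x,u) ∂_i(|x|^k) ≤ κ₁ |x|^{k-1} - κ₂ |x|^k`, where `∂_i(|x|^k) = k|x|^{k-2} x_i`. -/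
theorem stmt8 (d : ℕ) (hd : 1 ≤ d)
    (ℓ μ γ : Fin d → ℝ) (μo : Fin d → Fin d → ℝ)
    (hμ : ∀ i, 0 < μ i) (hγ : ∀ i, 0 < γ i) (hμo : ∀ i j, i ≠ j → 0 ≤ μo i j)
    (k : ℝ) (hk : 1 ≤ k) :
    ∃ κ₁ > (0 : ℝ), ∃ κ₂ > (0 : ℝ), ∀ x : E d, 1 ≤ ‖x‖ → ∀ u ∈ Mx d x,
      ∑ i, bf d ℓ μ γ μo x u i * (k * ‖x‖ ^ (k - 2) * x i) ≤
        κ₁ * ‖x‖ ^ (k - 1) - κ₂ * ‖x‖ ^ k := by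
  obtain ⟨ε, hε, hεb⟩ := exists_pos_le_and_mul_le hγ hμ
    (show (0 : ℝ) < (d : ℝ) ^ 2 + 1 / 2 by positivity)
  have hL : 0 ≤ ∑ i, |ℓ i| := sum_nonneg fun i _ => abs_nonneg _
  have hk0 : 0 < k := by linarith
  refine ⟨k * ((∑ i, |ℓ i|) + 1), by positivity, k * (ε / 2), by positivity,
    fun x hx u hu => ?_⟩
  have hx0 : 0 < ‖x‖ := by linarith
  have h1 : ‖x‖ ^ (k - 1) = ‖x‖ ^ (k - 2) * ‖x‖ := by
    rw [← Real.rpow_add_one hx0.ne']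
    ring_nf
  have h2 : ‖x‖ ^ k = ‖x‖ ^ (k - 2) * ‖x‖ ^ 2 := by
    rw [← Real.rpow_add_natCast hx0.ne']
    norm_num
  have hr : 0 < ‖x‖ ^ (k - 2) := Real.rpow_pos_of_pos hx0 _
  have hsum : ∑ i, bf d ℓ μ γ μo x u i * (k * ‖x‖ ^ (k - 2) * x i) =
      k * ‖x‖ ^ (k - 2) * ∑ i, bf d ℓ μ γ μo x u i * x i := by
    rw [mul_sum]
    exact sum_congr rfl fun i _ => by ring
  have hmain := mul_le_mul_of_nonneg_left (sum_bf_mul_le (ℓ := ℓ) hμo hε hεb hu)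
    (mul_pos hk0 hr).le
  have hextra := mul_pos (mul_pos hk0 hr) hx0
  rw [hsum, h1, h2]
  linarith
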